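/- Let Ω ⊂ ℝ² be a bounded domain and u_ε solutions of -Δu_ε - ε x·∇u_ε = f_ε with Dirichlet boundary condition, where ‖f_ε‖_{L¹} ≤ C. If z_ε solves the same problem and w_ε solves -Δw_ε = ε x·∇z_ε with Dirichlet condition, and ‖∇z_ε‖_{L^q} ≤ C_q for some 1 ≤ q < 2, then ‖w_ε‖_{C⁰(Ω̄)} is uniformly bounded, and z_ε - w_ε equals the solution u_ε of -Δu_ε = f_ε with Dirichlet condition. -/

import Mathlib

open MeasureTheory Real

/-- The Euclidean Laplacian `Δu = ∑ ∂²u/∂xᵢ²`. -/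
noncomputable def lap {n : ℕ} (u : EuclideanSpace ℝ (Fin n) → ℝ)
    (x : EuclideanSpace ℝ (Fin n)) : ℝ :=
  ∑ i : Fin n, iteratedFDeriv ℝ 2 u x ![EuclideanSpace.single i 1, EuclideanSpace.single i 1]

open Set Filter Topology

/-- The Euclidean plane. -/
abbrev Plane := EuclideanSpace ℝ (Fin 2)

/-- The restriction of `v` to the line `x + ℝ e` is twice differentiable at `x`, with second
derivative `D`. -/
def HasSecondLineDerivAt (v : Plane → ℝ) (D : ℝ) (x e : Plane) : Prop :=
  ∃ φ' : ℝ → ℝ, (∀ᶠ t in 𝓝 (0 : ℝ), HasDerivAt (fun t : ℝ => v (x + t • e)) (φ' t) t) ∧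
    HasDerivAt φ' D 0

namespace HasSecondLineDerivAt

variable {v v₁ v₂ : Plane → ℝ} {D D₁ D₂ : ℝ} {x e : Plane}

lemma add (h₁ : HasSecondLineDerivAt v₁ D₁ x e) (h₂ : HasSecondLineDerivAt v₂ D₂ x e) :
    HasSecondLineDerivAt (fun y => v₁ y + v₂ y) (D₁ + D₂) x e := by
  obtain ⟨φ₁, a₁, b₁⟩ := h₁
  obtain ⟨φ₂, a₂, b₂⟩ := h₂
  exact ⟨fun t => φ₁ t + φ₂ t, by filter_upwards [a₁, a₂] with t h h' using h.add h', b₁.add b₂⟩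

lemma const_mul (c : ℝ) (h : HasSecondLineDerivAt v D x e) :
    HasSecondLineDerivAt (fun y => c * v y) (c * D) x e := by
  obtain ⟨φ, a, b⟩ := h
  exact ⟨fun t => c * φ t, by filter_upwards [a] with t h using h.const_mul c, b.const_mul c⟩

lemma nonpos_of_isLocalMax (h : HasSecondLineDerivAt v D x e) (hmax : IsLocalMax v x) :
    D ≤ 0 := by
  obtain ⟨φ', h1, h2⟩ := h
  set φ : ℝ → ℝ := fun t => v (x + t • e) with hφ
  have hcont : Tendsto (fun t : ℝ => x + t • e) (𝓝 0) (𝓝 x) := by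
    have : Continuous (fun t : ℝ => x + t • e) := by fun_prop
    simpa using this.tendsto 0
  have hmax' : ∀ᶠ t in 𝓝 (0 : ℝ), φ t ≤ φ 0 := by
    filter_upwards [hcont.eventually hmax] with t ht
    simpa [hφ] using ht
  by_contra! hD
  have hd : deriv φ =ᶠ[𝓝 0] φ' := by filter_upwards [h1] with t ht using ht.deriv
  have hdd : deriv (deriv φ) 0 = D := by rw [hd.deriv_eq, h2.deriv]
  have hmin : IsLocalMin φ 0 :=
    isLocalMin_of_deriv_deriv_pos (by rw [hdd]; exact hD)
      (IsLocalMax.deriv_eq_zero hmax') h1.self_of_nhds.continuousAt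
  have heq : φ =ᶠ[𝓝 0] fun _ => φ 0 := by
    filter_upwards [hmax', hmin] with t a b using le_antisymm a b
  have h0 : deriv (deriv φ) 0 = 0 := by
    rw [heq.deriv.deriv_eq]; simp
  linarith

end HasSecondLineDerivAt

lemma ContDiffOn.hasSecondLineDerivAt {Ω : Set Plane} {w : Plane → ℝ} (hΩ : IsOpen Ω)
    (hw : ContDiffOn ℝ 2 w Ω) {x : Plane} (hx : x ∈ Ω) (e : Plane) :
    HasSecondLineDerivAt w (iteratedFDeriv ℝ 2 w x ![e, e]) x e := by
  have hline : ∀ t : ℝ, HasDerivAt (fun t : ℝ => x + t • e) e t := fun t => by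
    simpa using ((hasDerivAt_id t).smul_const e).const_add x
  have hcont : Tendsto (fun t : ℝ => x + t • e) (𝓝 0) (𝓝 x) := by
    simpa using (hline 0).continuousAt.tendsto
  refine ⟨fun t => fderiv ℝ w (x + t • e) e, ?_, ?_⟩
  · filter_upwards [hcont.eventually (hΩ.mem_nhds hx)] with t ht
    have h1 : HasFDerivAt w (fderiv ℝ w (x + t • e)) (x + t • e) :=
      ((hw.differentiableOn two_ne_zero).differentiableAt (hΩ.mem_nhds ht)).hasFDerivAt
    exact h1.comp_hasDerivAt t (hline t)
  · have h1 : ContDiffOn ℝ 1 (fderiv ℝ w) Ω := hw.fderiv_of_isOpen hΩ (by rw [one_add_one_eq_two])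
    have h2 : HasFDerivAt (fderiv ℝ w) (fderiv ℝ (fderiv ℝ w) x) x :=
      ((h1.differentiableOn one_ne_zero).differentiableAt (hΩ.mem_nhds hx)).hasFDerivAt
    have h3 : HasDerivAt (fun t : ℝ => fderiv ℝ w (x + t • e)) (fderiv ℝ (fderiv ℝ w) x e) 0 :=
      h2.comp_hasDerivAt_of_eq 0 (hline 0) (by simp)
    have h4 := h3.clm_apply (hasDerivAt_const (0 : ℝ) e)
    simpa [iteratedFDeriv_two_apply] using h4

lemma hasSecondLineDerivAt_norm_sq (x : Plane) (i : Fin 2) :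
    HasSecondLineDerivAt (fun y => ‖y‖ ^ 2) 2 x (EuclideanSpace.single i 1) := by
  have key : ∀ t : ℝ, ‖x + t • (EuclideanSpace.single i 1 : Plane)‖ ^ 2
      = ‖x‖ ^ 2 + 2 * x i * t + t ^ 2 := by
    intro t
    simp only [EuclideanSpace.real_norm_sq_eq, Fin.sum_univ_two]
    fin_cases i <;> simp <;> ring
  refine ⟨fun t => 2 * x i + 2 * t, Eventually.of_forall fun t => ?_, ?_⟩
  · simp only [key]
    have := (((hasDerivAt_id t).const_mul (2 * x i)).const_add (‖x‖ ^ 2)).add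
      ((hasDerivAt_id t).pow 2)
    refine (this.congr_deriv (by simp)).congr_of_eventuallyEq (Eventually.of_forall fun s => ?_)
    simp
  · simpa using ((hasDerivAt_id (0 : ℝ)).const_mul 2).const_add (2 * x i)

/-- A comparison form of the weak maximum principle: if `-Δw` is approximated from above, uniformly
on compact sets, by `-Δv` with `|v| ≤ M`, and `w ≤ 0` on the boundary, then `w ≤ 2M`. -/
lemma le_two_mul_of_approx_lap {Ω : Set Plane} (hΩ : IsOpen Ω) (hb : Bornology.IsBounded Ω)
    {w : Plane → ℝ} (hw : ContDiffOn ℝ 2 w Ω) (hwc : ContinuousOn w (closure Ω))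
    (hw0 : ∀ x ∈ frontier Ω, w x ≤ 0) {M : ℝ} (hM : 0 ≤ M)
    (h : ∀ K ⊆ Ω, IsCompact K → ∀ η > 0, ∃ (v : Plane → ℝ) (D : Plane → Fin 2 → ℝ),
      ContinuousOn v Ω ∧ (∀ x ∈ Ω, |v x| ≤ M) ∧ ∀ x ∈ K,
        (∀ i, HasSecondLineDerivAt v (D x i) x (EuclideanSpace.single i 1)) ∧
        ∑ i, D x i < lap w x + η) :
    ∀ x ∈ closure Ω, w x ≤ 2 * M := by
  intro x₀ hx₀
  by_cases hx₀Ω : x₀ ∉ Ω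
  · have : x₀ ∈ frontier Ω := by rw [hΩ.frontier_eq]; exact ⟨hx₀, hx₀Ω⟩
    linarith [hw0 x₀ this]
  push Not at hx₀Ω
  by_contra! hlt
  obtain ⟨R, hR⟩ := hb.exists_norm_le
  set η := w x₀ - 2 * M with hη
  have hηpos : 0 < η := by linarith
  set K := {x ∈ closure Ω | η / 2 ≤ w x} with hKdef
  have hKc : IsCompact K := by
    refine hb.isCompact_closure.of_isClosed_subset ?_ (fun x hx => hx.1)
    exact hwc.preimage_isClosed_of_isClosed isClosed_closure isClosed_Ici
  have hKΩ : K ⊆ Ω := by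
    rintro x ⟨hx, hx'⟩
    by_contra hn
    have : x ∈ frontier Ω := by rw [hΩ.frontier_eq]; exact ⟨hx, hn⟩
    linarith [hw0 x this]
  set μ := η / (4 * (R ^ 2 + 1)) with hμ
  have hμpos : 0 < μ := by positivity
  obtain ⟨v, D, hvc, hvM, hvK⟩ := h K hKΩ hKc (4 * μ) (by positivity)
  set m : Plane → ℝ := fun x => (w x + (-1) * v x) + μ * ‖x‖ ^ 2 with hm
  have hmc : ContinuousOn m K := by
    have := hwc.mono (fun x (hx : x ∈ K) => hx.1)
    have := hvc.mono hKΩ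
    fun_prop
  have hx₀K : x₀ ∈ K := ⟨hx₀, by linarith⟩
  obtain ⟨x₁, hx₁K, hx₁⟩ := hKc.exists_isMaxOn ⟨x₀, hx₀K⟩ hmc
  have hx₁Ω := hKΩ hx₁K
  rcases hx₁K.2.eq_or_lt with heq | hgt
  · have h1 : m x₀ ≤ m x₁ := hx₁ hx₀K
    simp only [hm] at h1
    have h2 := abs_le.1 (hvM x₀ hx₀Ω)
    have h3 := abs_le.1 (hvM x₁ hx₁Ω)
    have h4 : ‖x₁‖ ^ 2 ≤ R ^ 2 := pow_le_pow_left₀ (norm_nonneg _) (hR x₁ hx₁Ω) 2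
    have h5 : μ * ‖x₁‖ ^ 2 ≤ μ * (R ^ 2 + 1) :=
      mul_le_mul_of_nonneg_left (by linarith) hμpos.le
    have h6 : μ * (R ^ 2 + 1) = η / 4 := by rw [hμ]; field_simp
    have h7 : 0 ≤ μ * ‖x₀‖ ^ 2 := by positivity
    linarith
  · have hmem : K ∈ 𝓝 x₁ := by
      have hcw : ContinuousAt w x₁ := (hw.continuousOn).continuousAt (hΩ.mem_nhds hx₁Ω)
      filter_upwards [hΩ.mem_nhds hx₁Ω, hcw.eventually (lt_mem_nhds hgt)] with y hy hy'
      exact ⟨subset_closure hy, hy'.le⟩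
    have hloc : IsLocalMax m x₁ := hx₁.isLocalMax hmem
    obtain ⟨hD, hsum⟩ := hvK x₁ hx₁K
    have hi : ∀ i, (iteratedFDeriv ℝ 2 w x₁
        ![EuclideanSpace.single i 1, EuclideanSpace.single i 1] + (-1) * D x₁ i) + μ * 2 ≤ 0 :=
      fun i => ((((hw.hasSecondLineDerivAt hΩ hx₁Ω _).add ((hD i).const_mul (-1))).add
        ((hasSecondLineDerivAt_norm_sq x₁ i).const_mul μ)).nonpos_of_isLocalMax hloc)
    have h0 := hi 0
    have h1 := hi 1
    simp only [lap, Fin.sum_univ_two] at hsum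
    linarith

/-- The regularised logarithmic potential of `G` (up to sign, the Newtonian potential when
`d = 0`). -/
noncomputable def logPotential (d : ℝ) (G : Plane → ℝ) (x : Plane) : ℝ :=
  ∫ y, log (‖x - y‖ ^ 2 + d) * G y

lemma abs_log_le_add_inv {t : ℝ} (ht : 0 < t) : |log t| ≤ t + 1 / t := by
  have h1 := log_le_sub_one_of_pos ht
  have h2 := log_le_sub_one_of_pos (inv_pos.2 ht)
  rw [log_inv] at h2
  have h3 : 0 < t⁻¹ := inv_pos.2 ht
  rw [abs_le, one_div]
  constructor <;> linarith

section logPotential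

variable {d : ℝ} {G : Plane → ℝ} {R : ℝ}

lemma aestronglyMeasurable_log_mul (hd : 0 < d) (hG : Integrable G) (x : Plane) :
    AEStronglyMeasurable (fun y => log (‖x - y‖ ^ 2 + d) * G y) := by
  refine AEStronglyMeasurable.mul (Continuous.aestronglyMeasurable ?_) hG.aestronglyMeasurable
  exact Continuous.log (by fun_prop) fun y => by positivity

lemma norm_log_mul_le (hd : 0 < d) (hGR : ∀ y, R < ‖y‖ → G y = 0) {x : Plane} {r : ℝ}
    (hx : ‖x‖ ≤ r) (y : Plane) :
    ‖log (‖x - y‖ ^ 2 + d) * G y‖ ≤ ((r + R) ^ 2 + d + 1 / d) * ‖G y‖ := by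
  rw [norm_mul]
  by_cases hy : R < ‖y‖
  · simp [hGR y hy]
  · refine mul_le_mul_of_nonneg_right ?_ (norm_nonneg _)
    have h0 : 0 < ‖x - y‖ ^ 2 + d := by positivity
    have h1 : ‖x - y‖ ^ 2 ≤ (r + R) ^ 2 := by
      refine pow_le_pow_left₀ (norm_nonneg _) ((norm_sub_le _ _).trans ?_) 2
      linarith
    have h2 : 1 / (‖x - y‖ ^ 2 + d) ≤ 1 / d :=
      one_div_le_one_div_of_le hd (by linarith [sq_nonneg ‖x - y‖])
    have := abs_log_le_add_inv h0
    rw [Real.norm_eq_abs]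
    linarith

lemma integrable_log_mul (hd : 0 < d) (hG : Integrable G) (hGR : ∀ y, R < ‖y‖ → G y = 0)
    (x : Plane) : Integrable (fun y => log (‖x - y‖ ^ 2 + d) * G y) :=
  (hG.norm.const_mul _).mono' (aestronglyMeasurable_log_mul hd hG x)
    (Eventually.of_forall (norm_log_mul_le hd hGR le_rfl))

lemma continuous_logPotential (hd : 0 < d) (hG : Integrable G)
    (hGR : ∀ y, R < ‖y‖ → G y = 0) : Continuous (logPotential d G) := by
  rw [continuous_iff_continuousAt]
  intro x
  refine continuousAt_of_dominated
    (bound := fun y => ((‖x‖ + 1 + R) ^ 2 + d + 1 / d) * ‖G y‖)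
    (Eventually.of_forall (aestronglyMeasurable_log_mul hd hG)) ?_ (hG.norm.const_mul _) ?_
  · have : ∀ᶠ x' in 𝓝 x, ‖x'‖ < ‖x‖ + 1 :=
      (continuous_norm.continuousAt (x := x)).eventually (gt_mem_nhds (by simp))
    filter_upwards [this] with x' hx'
    exact Eventually.of_forall (norm_log_mul_le hd hGR hx'.le)
  · refine Eventually.of_forall fun y => Continuous.continuousAt ?_
    exact (Continuous.log (by fun_prop) fun x' => by positivity).mul continuous_const

lemma norm_sq_line (x y : Plane) (i : Fin 2) (t : ℝ) :
    ‖x + t • (EuclideanSpace.single i 1 : Plane) - y‖ ^ 2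
      = ‖x - y‖ ^ 2 + 2 * (x i - y i) * t + t ^ 2 := by
  simp only [EuclideanSpace.real_norm_sq_eq, Fin.sum_univ_two]
  fin_cases i <;> simp <;> ring

lemma sq_coord_le (x : Plane) (i : Fin 2) : x i ^ 2 ≤ ‖x‖ ^ 2 := by
  simp only [EuclideanSpace.real_norm_sq_eq, Fin.sum_univ_two]
  fin_cases i <;> simp <;> positivity

lemma hasSecondLineDerivAt_logPotential (hd : 0 < d) (hG : Integrable G)
    (hGR : ∀ y, R < ‖y‖ → G y = 0) (x : Plane) (i : Fin 2) :
    Integrable (fun y => (2 * (‖x - y‖ ^ 2 + d) - 4 * (x i - y i) ^ 2) /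
      (‖x - y‖ ^ 2 + d) ^ 2 * G y) ∧
    HasSecondLineDerivAt (logPotential d G)
      (∫ y, (2 * (‖x - y‖ ^ 2 + d) - 4 * (x i - y i) ^ 2) / (‖x - y‖ ^ 2 + d) ^ 2 * G y) x
      (EuclideanSpace.single i 1) := by
  set e : Plane := EuclideanSpace.single i 1 with he
  set N : ℝ → Plane → ℝ := fun t y => ‖x - y‖ ^ 2 + 2 * (x i - y i) * t + t ^ 2 + d with hN
  have hNe : ∀ t y, ‖x + t • e - y‖ ^ 2 + d = N t y := fun t y => by rw [norm_sq_line]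
  have hsq : ∀ t y, (x i - y i + t) ^ 2 + d ≤ N t y := fun t y => by
    have := sq_coord_le (x - y) i
    simp only [PiLp.sub_apply] at this
    simp only [hN]
    nlinarith
  have hNd : ∀ t y, d ≤ N t y := fun t y => by nlinarith [hsq t y, sq_nonneg (x i - y i + t)]
  have hNpos : ∀ t y, 0 < N t y := fun t y => hd.trans_le (hNd t y)
  have hNc : ∀ t, Continuous (N t) := fun t => by simp only [hN]; fun_prop
  have hNderiv : ∀ t y, HasDerivAt (fun t => N t y) (2 * (x i - y i + t)) t := fun t y => by
    have := ((((hasDerivAt_id t).const_mul (2 * (x i - y i))).const_add (‖x - y‖ ^ 2)).add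
      ((hasDerivAt_id t).pow 2)).add_const d
    refine (this.congr_deriv ?_).congr_of_eventuallyEq (Eventually.of_forall fun s => ?_)
    · simp; ring
    · simp [hN]
  set F₁ : ℝ → Plane → ℝ := fun t y => 2 * (x i - y i + t) / N t y * G y with hF₁
  set F₂ : ℝ → Plane → ℝ := fun t y =>
    (2 * N t y - 4 * (x i - y i + t) ^ 2) / N t y ^ 2 * G y with hF₂
  have hF₁m : ∀ t, AEStronglyMeasurable (F₁ t) := fun t => by
    refine AEStronglyMeasurable.mul (Continuous.aestronglyMeasurable ?_) hG.aestronglyMeasurable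
    exact Continuous.div (by fun_prop) (hNc t) fun y => (hNpos t y).ne'
  have hF₂m : ∀ t, AEStronglyMeasurable (F₂ t) := fun t => by
    refine AEStronglyMeasurable.mul (Continuous.aestronglyMeasurable ?_) hG.aestronglyMeasurable
    have := hNc t
    exact Continuous.div (by fun_prop) (by fun_prop) fun y => (pow_pos (hNpos t y) 2).ne'
  have hF₁b : ∀ t y, ‖F₁ t y‖ ≤ (1 + 1 / d) * ‖G y‖ := fun t y => by
    rw [hF₁, norm_mul]
    refine mul_le_mul_of_nonneg_right ?_ (norm_nonneg _)
    rw [Real.norm_eq_abs, abs_div, abs_of_pos (hNpos t y), div_le_iff₀ (hNpos t y)]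
    have h1 : 1 ≤ 1 / d * N t y := by
      rw [one_div, ← div_eq_inv_mul, le_div_iff₀ hd]; linarith [hNd t y]
    rw [abs_le]
    constructor <;> nlinarith [hsq t y, sq_nonneg (x i - y i + t - 1),
      sq_nonneg (x i - y i + t + 1)]
  have hF₂b : ∀ t y, ‖F₂ t y‖ ≤ 2 / d * ‖G y‖ := fun t y => by
    rw [hF₂, norm_mul]
    refine mul_le_mul_of_nonneg_right ?_ (norm_nonneg _)
    have h0 := hNpos t y
    rw [Real.norm_eq_abs, abs_div, abs_of_pos (pow_pos h0 2), div_le_div_iff₀ (by positivity) hd]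
    have h1 : |2 * N t y - 4 * (x i - y i + t) ^ 2| ≤ 2 * N t y := by
      rw [abs_le]
      constructor <;> nlinarith [hsq t y, sq_nonneg (x i - y i + t)]
    have h2 := mul_le_mul h1 (hNd t y) hd.le (by positivity)
    nlinarith
  have hI₁ : ∀ t, Integrable (F₁ t) := fun t =>
    (hG.norm.const_mul _).mono' (hF₁m t) (Eventually.of_forall (hF₁b t))
  have D₁ : ∀ t : ℝ, HasDerivAt (fun t => logPotential d G (x + t • e)) (∫ y, F₁ t y) t := by
    intro t
    refine (hasDerivAt_integral_of_dominated_loc_of_deriv_le (s := univ)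
      (F := fun t y => log (‖x + t • e - y‖ ^ 2 + d) * G y) (F' := F₁) univ_mem
      (Eventually.of_forall fun t => aestronglyMeasurable_log_mul hd hG _)
      (integrable_log_mul hd hG hGR _) (hF₁m t)
      (Eventually.of_forall fun y t _ => hF₁b t y) (hG.norm.const_mul _)
      (Eventually.of_forall fun y t _ => ?_)).2
    simp only [hNe]
    exact ((hNderiv t y).log (hNpos t y).ne').mul_const _
  have D₂ := hasDerivAt_integral_of_dominated_loc_of_deriv_le (s := univ)
      (x₀ := (0 : ℝ)) (F := F₁) (F' := F₂) univ_mem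
      (Eventually.of_forall hF₁m) (hI₁ 0) (hF₂m 0)
      (Eventually.of_forall fun y t _ => hF₂b t y) (hG.norm.const_mul _)
      (Eventually.of_forall fun y t _ => by
        have h1 : HasDerivAt (fun t : ℝ => 2 * (x i - y i + t)) 2 t := by
          simpa using ((hasDerivAt_id t).const_add (x i - y i)).const_mul 2
        refine ((h1.div (hNderiv t y) (hNpos t y).ne').mul_const (G y)).congr_deriv ?_
        simp only [hF₂]
        ring)
  have hF₂0 : F₂ 0 = fun y => (2 * (‖x - y‖ ^ 2 + d) - 4 * (x i - y i) ^ 2) /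
      (‖x - y‖ ^ 2 + d) ^ 2 * G y := by
    funext y; simp [hF₂, hN]
  rw [hF₂0] at D₂
  exact ⟨D₂.1, fun t => ∫ y, F₁ t y, Eventually.of_forall D₁, D₂.2⟩

end logPotential

/-- The Laplacian of `log (‖s‖² + d) / (4π)`, a regularisation of the Dirac mass. -/
noncomputable def approxDelta (d : ℝ) (s : Plane) : ℝ := d / (π * (‖s‖ ^ 2 + d) ^ 2)

lemma exists_secondLineDeriv_logPotential {d R : ℝ} {G : Plane → ℝ} (hd : 0 < d)
    (hG : Integrable G) (hGR : ∀ y, R < ‖y‖ → G y = 0) :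
    ∃ D : Plane → Fin 2 → ℝ, ∀ x,
      (∀ i, HasSecondLineDerivAt (logPotential d G) (D x i) x (EuclideanSpace.single i 1)) ∧
      ∑ i, D x i = 4 * π * ∫ y, approxDelta d (x - y) * G y := by
  refine ⟨_, fun x => ⟨fun i => (hasSecondLineDerivAt_logPotential hd hG hGR x i).2, ?_⟩⟩
  rw [Fin.sum_univ_two, ← integral_add (hasSecondLineDerivAt_logPotential hd hG hGR x 0).1
    (hasSecondLineDerivAt_logPotential hd hG hGR x 1).1, ← integral_const_mul]
  congr 1
  funext y
  have hn : ‖x - y‖ ^ 2 = (x 0 - y 0) ^ 2 + (x 1 - y 1) ^ 2 := by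
    simp [EuclideanSpace.real_norm_sq_eq, Fin.sum_univ_two]
  have h0 : (x 0 - y 0) ^ 2 + (x 1 - y 1) ^ 2 + d ≠ 0 := by positivity
  rw [approxDelta, hn]
  field_simp
  ring

lemma continuous_approxDelta {d : ℝ} (hd : 0 < d) : Continuous (approxDelta d) :=
  Continuous.div (by fun_prop) (by fun_prop) fun s => by positivity

lemma approxDelta_nonneg {d : ℝ} (hd : 0 < d) (s : Plane) : 0 ≤ approxDelta d s := by
  unfold approxDelta; positivity

lemma integrable_and_integral_approxDelta {d : ℝ} (hd : 0 < d) :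
    Integrable (approxDelta d) ∧ ∫ s, approxDelta d s = 1 := by
  set f : ℝ → ℝ := fun r => d / (π * (r ^ 2 + d) ^ 2) with hf
  have hfe : approxDelta d = fun s => f ‖s‖ := rfl
  have hg : ∀ r : ℝ, HasDerivAt (fun r => -(d / (2 * π)) * (r ^ 2 + d)⁻¹) (r * f r) r := by
    intro r
    have h0 : r ^ 2 + d ≠ 0 := by positivity
    have h1 : HasDerivAt (fun r : ℝ => r ^ 2 + d) (2 * r) r := by
      simpa using (hasDerivAt_pow 2 r).add_const d
    refine ((h1.inv h0).const_mul _).congr_deriv ?_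
    simp only [hf]
    field_simp
  have hlim : Tendsto (fun r : ℝ => -(d / (2 * π)) * (r ^ 2 + d)⁻¹) atTop (𝓝 0) := by
    have : Tendsto (fun r : ℝ => (r ^ 2 + d)⁻¹) atTop (𝓝 0) :=
      (tendsto_atTop_add_const_right _ _ (tendsto_pow_atTop two_ne_zero)).inv_tendsto_atTop
    simpa using this.const_mul (-(d / (2 * π)))
  have hpos : ∀ r ∈ Ioi (0 : ℝ), 0 ≤ r * f r := fun r (hr : 0 < r) => by
    simp only [hf]; positivity
  have hI := integrableOn_Ioi_deriv_of_nonneg' (fun r _ => hg r) hpos hlim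
  have hV := integral_Ioi_of_hasDerivAt_of_nonneg' (fun r _ => hg r) hpos hlim
  have hvol : volume.real (Metric.ball (0 : Plane) 1) = π := by
    rw [Measure.real, EuclideanSpace.volume_ball_fin_two]
    simp [pi_pos.le]
  rw [hfe]
  constructor
  · rw [integrable_fun_norm_addHaar (volume : Measure Plane)]
    simpa using hI
  · rw [integral_fun_norm_addHaar (volume : Measure Plane), hvol]
    simp only [finrank_euclideanSpace, Fintype.card_fin, smul_eq_mul, Nat.reduceSub, pow_one,
      nsmul_eq_mul]
    rw [hV]
    have := pi_pos.ne'
    push_cast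
    field_simp
    simp

/-- `approxDelta d` is an approximate identity, locally uniformly where `G` is continuous. -/
lemma exists_approxDelta_close {G : Plane → ℝ} (hG : Integrable G) {K : Set Plane}
    (hK : IsCompact K) (hGK : ∀ x ∈ K, ContinuousAt G x) {η : ℝ} (hη : 0 < η) :
    ∃ d : ℝ, 0 < d ∧ d ≤ 1 ∧ ∀ x ∈ K, |(∫ y, approxDelta d (x - y) * G y) - G x| < η := by
  obtain ⟨r, hr, hrG⟩ := Metric.mem_uniformity_dist.1
    (hK.uniformContinuousAt_of_continuousAt G hGK (Metric.dist_mem_uniformity (half_pos hη)))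
  obtain ⟨S, hS⟩ := hK.exists_bound_of_continuousOn
    (fun x hx => (hGK x hx).continuousWithinAt)
  set A := (1 + 1 / r ^ 2) ^ 2 with hA
  set B := (1 / r ^ 2) ^ 2 with hB
  set T := B * (∫ y, ‖G y‖) + |S| * A with hT
  have hTpos : 0 ≤ T := by positivity
  obtain ⟨hI1, hV1⟩ := integrable_and_integral_approxDelta one_pos
  set d := min 1 (η / (4 * (T + 1))) with hd'
  have hd : 0 < d := lt_min one_pos (by positivity)
  have hd1 : d ≤ 1 := min_le_left _ _
  have hdT : d * T < η / 2 := by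
    have : d * (T + 1) ≤ η / 4 := by
      calc d * (T + 1) ≤ η / (4 * (T + 1)) * (T + 1) :=
            mul_le_mul_of_nonneg_right (min_le_right _ _) (by positivity)
        _ = η / 4 := by field_simp
    nlinarith
  obtain ⟨hId, hVd⟩ := integrable_and_integral_approxDelta hd
  refine ⟨d, hd, hd1, fun x hx => ?_⟩
  have hId' := hId.comp_sub_left x
  have hI1' := hI1.comp_sub_left x
  have hVd' : ∫ y, approxDelta d (x - y) = 1 := by
    rw [integral_sub_left_eq_self (approxDelta d) volume x, hVd]
  have hV1' : ∫ y, approxDelta 1 (x - y) = 1 := by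
    rw [integral_sub_left_eq_self (approxDelta 1) volume x, hV1]
  have hbd : ∀ y, approxDelta d (x - y) ≤ 1 / d := fun y => by
    rw [approxDelta, div_le_div_iff₀ (by positivity) hd]
    have h1 : d * d ≤ (‖x - y‖ ^ 2 + d) ^ 2 := by nlinarith [sq_nonneg ‖x - y‖]
    have h2 : (1 : ℝ) ≤ π := by linarith [pi_gt_three]
    nlinarith [sq_nonneg (‖x - y‖ ^ 2 + d)]
  have hIG : Integrable (fun y => approxDelta d (x - y) * G y) := by
    refine (hG.norm.const_mul (1 / d)).mono' (AEStronglyMeasurable.mul ?_ hG.1)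
      (Eventually.of_forall fun y => ?_)
    · exact ((continuous_approxDelta hd).comp (by fun_prop)).aestronglyMeasurable
    · rw [norm_mul, Real.norm_of_nonneg (approxDelta_nonneg hd _)]
      exact mul_le_mul_of_nonneg_right (hbd y) (norm_nonneg _)
  have hdiff : (∫ y, approxDelta d (x - y) * G y) - G x
      = ∫ y, approxDelta d (x - y) * (G y - G x) := by
    simp only [mul_sub]
    rw [integral_sub hIG (hId'.mul_const _), integral_mul_const, hVd', one_mul]
  have hpt : ∀ y, ‖approxDelta d (x - y) * (G y - G x)‖ ≤
      η / 2 * approxDelta d (x - y) +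
        d * (B * ‖G y‖ + |S| * A * approxDelta 1 (x - y)) := by
    intro y
    have hδ := approxDelta_nonneg hd (x - y)
    have hδ1 := approxDelta_nonneg one_pos (x - y)
    rw [norm_mul, Real.norm_of_nonneg hδ]
    by_cases hxy : dist x y < r
    · have h1 : dist (G x) (G y) < η / 2 := hrG hxy hx
      rw [dist_comm, Real.dist_eq] at h1
      rw [Real.norm_eq_abs]
      have h2 : 0 ≤ d * (B * ‖G y‖ + |S| * A * approxDelta 1 (x - y)) := by positivity
      nlinarith
    · push Not at hxy
      rw [dist_eq_norm] at hxy
      set ρ := ‖x - y‖ ^ 2 with hρ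
      have hρr : r ^ 2 ≤ ρ := pow_le_pow_left₀ hr.le hxy 2
      have hρ0 : 0 < ρ := lt_of_lt_of_le (by positivity) hρr
      have h1 : 1 ≤ 1 / r ^ 2 * ρ := by
        rw [one_div, ← div_eq_inv_mul, le_div_iff₀ (by positivity)]; linarith
      have h2 : approxDelta d (x - y) ≤ d * B := by
        rw [approxDelta, ← hρ, div_le_iff₀ (by positivity), mul_assoc]
        refine le_mul_of_one_le_right hd.le ?_
        have h3 : 1 ≤ 1 / r ^ 2 * (ρ + d) := by
          have : 0 ≤ 1 / r ^ 2 * d := by positivity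
          linarith
        have h4 : 1 ≤ (1 / r ^ 2 * (ρ + d)) ^ 2 := one_le_pow₀ h3
        rw [mul_pow, ← hB] at h4
        have : (1 : ℝ) ≤ π := by linarith [pi_gt_three]
        nlinarith
      have h3 : approxDelta d (x - y) ≤ d * (A * approxDelta 1 (x - y)) := by
        rw [approxDelta, approxDelta, ← hρ, div_eq_mul_one_div]
        refine mul_le_mul_of_nonneg_left ?_ hd.le
        rw [mul_one_div, div_le_div_iff₀ (by positivity) (by positivity), hA]
        have h4 : ρ + 1 ≤ (1 + 1 / r ^ 2) * (ρ + d) := by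
          have : 0 ≤ 1 / r ^ 2 * d := by positivity
          linarith
        have h5 : (ρ + 1) ^ 2 ≤ ((1 + 1 / r ^ 2) * (ρ + d)) ^ 2 :=
          pow_le_pow_left₀ (by positivity) h4 2
        rw [mul_pow] at h5
        nlinarith [pi_pos]
      have h4 : ‖G y - G x‖ ≤ ‖G y‖ + |S| :=
        (norm_sub_le _ _).trans (by linarith [hS x hx, le_abs_self S])
      have h5 : approxDelta d (x - y) * ‖G y - G x‖ ≤
          approxDelta d (x - y) * ‖G y‖ + approxDelta d (x - y) * |S| := by
        rw [← mul_add]; exact mul_le_mul_of_nonneg_left h4 hδ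
      have h6 := mul_le_mul_of_nonneg_right h2 (norm_nonneg (G y))
      have h7 := mul_le_mul_of_nonneg_right h3 (abs_nonneg S)
      have h8 : 0 ≤ η / 2 * approxDelta d (x - y) := by positivity
      linarith
  have hIc : Integrable (fun y => d * (B * ‖G y‖ + |S| * A * approxDelta 1 (x - y))) :=
    ((hG.norm.const_mul _).add (hI1'.const_mul _)).const_mul _
  have hVb : ∫ y, (η / 2 * approxDelta d (x - y) +
      d * (B * ‖G y‖ + |S| * A * approxDelta 1 (x - y))) = η / 2 + d * T := by
    rw [integral_add (hId'.const_mul _) hIc, integral_const_mul,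
      integral_const_mul, integral_add (hG.norm.const_mul _) (hI1'.const_mul _),
      integral_const_mul, integral_const_mul, hVd', hV1', hT]
    ring
  rw [hdiff]
  have := norm_integral_le_of_norm_le ((hId'.const_mul _).add hIc) (Eventually.of_forall hpt)
  simp only [Pi.add_apply] at this
  rw [hVb, Real.norm_eq_abs] at this
  linarith

lemma ae_fderiv_eq_zero_of_zero {Ω : Set Plane} {z : Plane → ℝ} (hΩ : IsOpen Ω)
    (hz : DifferentiableOn ℝ z Ω) :
    ∀ᵐ x ∂volume.restrict Ω, z x = 0 → fderiv ℝ z x = 0 := by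
  set s : Set Plane := Ω ∩ z ⁻¹' {0} with hs
  have hsm : MeasurableSet s := by
    obtain ⟨u, hu, hu'⟩ := continuousOn_iff_isClosed.1 hz.continuousOn {0} isClosed_singleton
    rw [hs, inter_comm, hu']
    exact hu.measurableSet.inter hΩ.measurableSet
  set e : Plane := EuclideanSpace.single 0 1 with he
  have he1 : ‖e‖ = 1 := by simp [he]
  have happ : ApproximatesLinearOn (fun x => z x • e) (0 : Plane →L[ℝ] Plane) s 0 := by
    intro x hx y hy
    simp [show z x = 0 from hx.2, show z y = 0 from hy.2]
  have h := happ.norm_fderiv_sub_le volume hsm (fun x => (fderiv ℝ z x).smulRight e)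
    (fun x hx => (((hz.differentiableAt (hΩ.mem_nhds hx.1)).hasFDerivAt.smul_const
      e)).hasFDerivWithinAt)
  rw [ae_restrict_iff' hsm] at h
  rw [ae_restrict_iff' hΩ.measurableSet]
  filter_upwards [h] with x hx hxΩ hzx
  have h1 := hx ⟨hxΩ, hzx⟩
  rw [sub_zero, nonpos_iff_eq_zero, nnnorm_eq_zero] at h1
  ext y
  have h2 := congrArg (fun A : Plane →L[ℝ] Plane => ‖A y‖) h1
  simpa [norm_smul, he1] using h2

/-- A continuous cutoff on `ℝ` that vanishes where `n |s| ≤ 1` and equals `1` where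
`n |s| ≥ 2`. -/
noncomputable def cutoff (n : ℕ) (s : ℝ) : ℝ := min (max (n * |s| - 1) 0) 1

lemma continuous_cutoff (n : ℕ) : Continuous (cutoff n) := by unfold cutoff; fun_prop

lemma cutoff_nonneg (n : ℕ) (s : ℝ) : 0 ≤ cutoff n s := by simp [cutoff]

lemma cutoff_le_one (n : ℕ) (s : ℝ) : cutoff n s ≤ 1 := min_le_right _ _

lemma cutoff_eq_zero {n : ℕ} {s : ℝ} (h : n * |s| ≤ 1) : cutoff n s = 0 := by
  rw [cutoff, max_eq_right (by linarith)]; simp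

lemma tendsto_cutoff {s : ℝ} (hs : s ≠ 0) : Tendsto (fun n => cutoff n s) atTop (𝓝 1) := by
  obtain ⟨k, hk⟩ := exists_nat_gt (2 / |s|)
  refine tendsto_const_nhds.congr' ?_
  filter_upwards [eventually_ge_atTop k] with n hn
  have hs' : 0 < |s| := abs_pos.2 hs
  have h1 : 2 < k * |s| := by rwa [div_lt_iff₀ hs'] at hk
  have h2 : (k : ℝ) * |s| ≤ n * |s| := by gcongr
  rw [cutoff, min_eq_right]
  exact le_max_of_le_left (by linarith)

/-- The primitive of `cutoff n`: a `C¹` truncation vanishing near the origin. -/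
noncomputable def trunc (n : ℕ) (s : ℝ) : ℝ := ∫ t in (0 : ℝ)..s, cutoff n t

lemma hasDerivAt_trunc (n : ℕ) (s : ℝ) : HasDerivAt (trunc n) (cutoff n s) s :=
  intervalIntegral.integral_hasDerivAt_right ((continuous_cutoff n).intervalIntegrable _ _)
    (continuous_cutoff n).aestronglyMeasurable.stronglyMeasurableAtFilter
    (continuous_cutoff n).continuousAt

lemma trunc_eq_zero {n : ℕ} {s : ℝ} (h : n * |s| ≤ 1) : trunc n s = 0 := by
  rw [trunc, intervalIntegral.integral_congr (g := fun _ => (0 : ℝ)), intervalIntegral.integral_zero]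
  intro t ht
  refine cutoff_eq_zero (le_trans ?_ h)
  have : |t| ≤ |s| := by
    simpa using abs_sub_left_of_mem_uIcc ht
  gcongr

section truncation

variable {Ω : Set Plane} {z : Plane → ℝ}

lemma hasFDerivAt_indicator_trunc (hΩ : IsOpen Ω) (hz : DifferentiableOn ℝ z Ω)
    (hzc : ContinuousOn z (closure Ω)) (hz0 : ∀ x ∈ frontier Ω, z x = 0) (n : ℕ) (x : Plane) :
    HasFDerivAt (Ω.indicator fun y => trunc n (z y))
      (Ω.indicator (fun y => cutoff n (z y) • fderiv ℝ z y) x) x := by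
  by_cases hx : x ∈ Ω
  · rw [indicator_of_mem hx]
    refine ((hasDerivAt_trunc n (z x)).comp_hasFDerivAt x
      (hz.differentiableAt (hΩ.mem_nhds hx)).hasFDerivAt).congr_of_eventuallyEq ?_
    filter_upwards [hΩ.mem_nhds hx] with y hy
    simp [hy]
  · rw [indicator_of_notMem hx]
    refine (hasFDerivAt_const (0 : ℝ) x).congr_of_eventuallyEq ?_
    by_cases hx' : x ∈ closure Ω
    · have hfr : x ∈ frontier Ω := by rw [hΩ.frontier_eq]; exact ⟨hx', hx⟩
      have hlim : Tendsto (fun y => n * |z y|) (𝓝[closure Ω] x) (𝓝 0) := by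
        have := ((hzc x hx').abs.const_mul (n : ℝ))
        simpa [hz0 x hfr] using this.tendsto
      have := eventually_nhdsWithin_iff.1 (hlim.eventually (gt_mem_nhds one_pos))
      filter_upwards [this] with y hy
      by_cases hyΩ : y ∈ Ω
      · rw [indicator_of_mem hyΩ]
        exact trunc_eq_zero (hy (subset_closure hyΩ)).le
      · rw [indicator_of_notMem hyΩ]
    · filter_upwards [isClosed_closure.isOpen_compl.mem_nhds hx'] with y hy
      exact indicator_of_notMem (fun h => hy (subset_closure h)) _

/-- The gradient of a function vanishing on `∂Ω` is orthogonal to bounded divergence-free fields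
`(G₀, G₁)`. -/
lemma setIntegral_divergence_free_eq_zero (hΩ : IsOpen Ω) (hb : Bornology.IsBounded Ω)
    (hz : ContDiffOn ℝ 1 z Ω)
    (hzc : ContinuousOn z (closure Ω)) (hz0 : ∀ x ∈ frontier Ω, z x = 0)
    (hint : IntegrableOn (fderiv ℝ z) Ω) {G₀ G₁ H : Plane → ℝ}
    (h₀c : Continuous G₀) (h₁c : Continuous G₁) (hHc : Continuous H)
    (h₀ : ∀ x, HasLineDerivAt ℝ G₀ (H x) x (EuclideanSpace.single 0 1))
    (h₁ : ∀ x, HasLineDerivAt ℝ G₁ (-H x) x (EuclideanSpace.single 1 1)) :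
    ∫ x in Ω, (G₀ x * fderiv ℝ z x (EuclideanSpace.single 0 1) +
      G₁ x * fderiv ℝ z x (EuclideanSpace.single 1 1)) = 0 := by
  have hΩm := hΩ.measurableSet
  have hd : DifferentiableOn ℝ z Ω := hz.differentiableOn one_ne_zero
  have hmulint : ∀ (G : Plane → ℝ) (e : Plane), Continuous G →
      IntegrableOn (fun x => G x * fderiv ℝ z x e) Ω := fun G e hG => by
    obtain ⟨S, hS⟩ := hb.isCompact_closure.exists_bound_of_continuousOn hG.continuousOn
    refine (hint.apply_continuousLinearMap e).bdd_mul (c := S)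
      hG.aestronglyMeasurable.restrict ?_
    exact (ae_restrict_iff' hΩm).2 (Eventually.of_forall fun x hx => hS x (subset_closure hx))
  have hcut : ∀ n, ContinuousOn (fun x => cutoff n (z x)) Ω := fun n =>
    (continuous_cutoff n).comp_continuousOn hd.continuousOn
  set P : Plane → ℝ := fun x => G₀ x * fderiv ℝ z x (EuclideanSpace.single 0 1) +
      G₁ x * fderiv ℝ z x (EuclideanSpace.single 1 1) with hP
  have hPint : IntegrableOn P Ω := (hmulint _ _ h₀c).add (hmulint _ _ h₁c)
  have hzero : ∀ n : ℕ, ∫ x in Ω, cutoff n (z x) * P x = 0 := by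
    intro n
    set g : Plane → ℝ := Ω.indicator fun y => trunc n (z y) with hg
    have hgd := hasFDerivAt_indicator_trunc hΩ hd hzc hz0 n
    have hgc : Continuous g := continuous_iff_continuousAt.2 fun x => (hgd x).continuousAt
    have hgs : HasCompactSupport g :=
      HasCompactSupport.intro hb.isCompact_closure fun x hx =>
        indicator_of_notMem (fun h => hx (subset_closure h)) _
    have hcutint : ∀ (G : Plane → ℝ) (e : Plane), Continuous G →
        IntegrableOn (fun x => cutoff n (z x) * (G x * fderiv ℝ z x e)) Ω := fun G e hG => by
      refine (hmulint G e hG).bdd_mul (c := 1) ((hcut n).aestronglyMeasurable hΩm)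
        (Eventually.of_forall fun x => ?_)
      rw [Real.norm_of_nonneg (cutoff_nonneg _ _)]
      exact cutoff_le_one _ _
    have hform : ∀ (G : Plane → ℝ) (e : Plane),
        (fun x => G x * (Ω.indicator (fun y => cutoff n (z y) • fderiv ℝ z y) x) e)
          = Ω.indicator (fun x => cutoff n (z x) * (G x * fderiv ℝ z x e)) := by
      intro G e
      funext x
      by_cases hx : x ∈ Ω
      · simp [hx]; ring
      · simp [hx]
    have hparts : ∀ (G G' : Plane → ℝ) (e : Plane), Continuous G → Continuous G' →
        (∀ x, HasLineDerivAt ℝ G (G' x) x e) →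
        ∫ x in Ω, cutoff n (z x) * (G x * fderiv ℝ z x e) = - ∫ x, G' x * g x := by
      intro G G' e hG hG' hGd
      have := integral_bilinear_hasLineDerivAt_right_eq_neg_left_of_integrable
        (μ := (volume : Measure Plane)) (f := G) (f' := G') (g := g)
        (g' := fun x => (Ω.indicator (fun y => cutoff n (z y) • fderiv ℝ z y) x) e) (v := e)
        (B := ContinuousLinearMap.mul ℝ ℝ)
        ((hG'.mul hgc).integrable_of_hasCompactSupport hgs.mul_left)
        (by
          simp only [ContinuousLinearMap.mul_apply', hform]
          exact (hcutint G e hG).integrable_indicator hΩm)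
        ((hG.mul hgc).integrable_of_hasCompactSupport hgs.mul_left)
        (fun x _ => hGd x) (fun x _ => (hgd x).hasLineDerivAt e)
      simp only [ContinuousLinearMap.mul_apply'] at this
      rw [← this, hform, integral_indicator hΩm]
    have e₀ := hparts G₀ H _ h₀c hHc h₀
    have e₁ := hparts G₁ (fun x => -H x) _ h₁c hHc.neg h₁
    simp only [hP, mul_add]
    rw [integral_add (hcutint _ _ h₀c) (hcutint _ _ h₁c), e₀, e₁]
    simp [integral_neg]
  have hlim : Tendsto (fun n : ℕ => ∫ x in Ω, cutoff n (z x) * P x) atTop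
      (𝓝 (∫ x in Ω, P x)) := by
    refine tendsto_integral_of_dominated_convergence (fun x => ‖P x‖)
      (fun n => ((hcut n).aestronglyMeasurable hΩm).mul hPint.aestronglyMeasurable)
      hPint.norm (fun n => Eventually.of_forall fun x => ?_) ?_
    · rw [norm_mul, Real.norm_of_nonneg (cutoff_nonneg _ _)]
      exact mul_le_of_le_one_left (norm_nonneg _) (cutoff_le_one _ _)
    · filter_upwards [ae_fderiv_eq_zero_of_zero hΩ hd] with x hx
      by_cases hzx : z x = 0
      · simp [hP, hx hzx]
      · simpa using (tendsto_cutoff hzx).mul_const (P x)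
  simp only [hzero] at hlim
  exact tendsto_nhds_unique hlim tendsto_const_nhds

end truncation

lemma integral_log_mul_fderiv_bound {Ω : Set Plane} {z : Plane → ℝ} (hΩ : IsOpen Ω)
    (hb : Bornology.IsBounded Ω) (hz : ContDiffOn ℝ 1 z Ω)
    (hzc : ContinuousOn z (closure Ω)) (hz0 : ∀ x ∈ frontier Ω, z x = 0)
    (hint : IntegrableOn (fderiv ℝ z) Ω) {R : ℝ} (hR : ∀ x ∈ Ω, ‖x‖ ≤ R)
    {d : ℝ} (hd : 0 < d) (hd1 : d ≤ 1) {x : Plane} (hx : x ∈ Ω) :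
    |∫ y in Ω, log (‖x - y‖ ^ 2 + d) * fderiv ℝ z y y| ≤
      (8 * R ^ 2 + 4 + 2 * R) * ∫ y in Ω, ‖fderiv ℝ z y‖ := by
  set e₀ : Plane := EuclideanSpace.single 0 1 with he₀
  set e₁ : Plane := EuclideanSpace.single 1 1 with he₁
  set a := x 0 with ha
  set b := x 1 with hb'
  set N : Plane → ℝ := fun y => ‖y - x‖ ^ 2 + d with hN
  set ℓ : Plane → ℝ := fun y => a * (y 1 - b) - b * (y 0 - a) with hℓ
  have hNpos : ∀ y, 0 < N y := fun y => by simp only [hN]; positivity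
  have hNne : ∀ y, N y ≠ 0 := fun y => (hNpos y).ne'
  have hNc : Continuous N := by simp only [hN]; fun_prop
  have hℓc : Continuous ℓ := by simp only [hℓ]; fun_prop
  set G₀ : Plane → ℝ := fun y => a * log (N y) + 2 * ℓ y * (y 1 - b) / N y with hG₀
  set G₁ : Plane → ℝ := fun y => b * log (N y) - 2 * ℓ y * (y 0 - a) / N y with hG₁
  set H : Plane → ℝ := fun y => 2 * a * (y 0 - a) / N y - 2 * b * (y 1 - b) / N y
    - 4 * ℓ y * (y 0 - a) * (y 1 - b) / N y ^ 2 with hH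
  have hG₀c : Continuous G₀ := (continuous_const.mul (hNc.log hNne)).add
    (Continuous.div (by fun_prop) hNc hNne)
  have hG₁c : Continuous G₁ := (continuous_const.mul (hNc.log hNne)).sub
    (Continuous.div (by fun_prop) hNc hNne)
  have hHc : Continuous H := ((Continuous.div (by fun_prop) hNc hNne).sub
    (Continuous.div (by fun_prop) hNc hNne)).sub
    (Continuous.div (by fun_prop) (by fun_prop) fun y => pow_ne_zero 2 (hNne y))
  have hNd : ∀ (y : Plane) (i : Fin 2), HasDerivAt
      (fun t : ℝ => N (y + t • (EuclideanSpace.single i 1 : Plane))) (2 * (y i - x i)) 0 := by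
    intro y i
    simp only [hN, norm_sq_line]
    have := ((((hasDerivAt_id (0 : ℝ)).const_mul (2 * (y i - x i))).const_add
      (‖y - x‖ ^ 2)).add ((hasDerivAt_id (0 : ℝ)).pow 2)).add_const d
    refine (this.congr_deriv (by simp)).congr_of_eventuallyEq (Eventually.of_forall fun s => ?_)
    simp
  have hℓd₀ : ∀ y : Plane, HasDerivAt (fun t : ℝ => ℓ (y + t • e₀)) (-b) 0 := by
    intro y
    have := ((hasDerivAt_id (0 : ℝ)).const_mul (-b)).const_add (ℓ y)
    refine (this.congr_deriv (by simp)).congr_of_eventuallyEq (Eventually.of_forall fun s => ?_)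
    simp [hℓ, he₀]; ring
  have hℓd₁ : ∀ y : Plane, HasDerivAt (fun t : ℝ => ℓ (y + t • e₁)) a 0 := by
    intro y
    have := ((hasDerivAt_id (0 : ℝ)).const_mul a).const_add (ℓ y)
    refine (this.congr_deriv (by simp)).congr_of_eventuallyEq (Eventually.of_forall fun s => ?_)
    simp [hℓ, he₁]; ring
  have h₀ : ∀ y, HasLineDerivAt ℝ G₀ (H y) y e₀ := by
    intro y
    have hN' := hNd y 0
    have hne : N (y + (0 : ℝ) • e₀) ≠ 0 := hNne _
    have h1 := ((hN'.log hne).const_mul a).add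
      ((((hℓd₀ y).const_mul 2).mul_const (y 1 - b)).div hN' hne)
    refine (h1.congr_deriv ?_).congr_of_eventuallyEq (Eventually.of_forall fun s => ?_)
    · have := hNne y
      simp only [hH, zero_smul, add_zero, ← ha]
      field_simp
      ring
    · simp [hG₀, he₀]
  have h₁ : ∀ y, HasLineDerivAt ℝ G₁ (-H y) y e₁ := by
    intro y
    have hN' := hNd y 1
    have hne : N (y + (0 : ℝ) • e₁) ≠ 0 := hNne _
    have h1 := ((hN'.log hne).const_mul b).sub
      ((((hℓd₁ y).const_mul 2).mul_const (y 0 - a)).div hN' hne)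
    refine (h1.congr_deriv ?_).congr_of_eventuallyEq (Eventually.of_forall fun s => ?_)
    · have := hNne y
      simp only [hH, zero_smul, add_zero, ← hb']
      field_simp
      ring
    · simp [hG₁, he₁]
  have hdiv := setIntegral_divergence_free_eq_zero hΩ hb hz hzc hz0 hint hG₀c hG₁c hHc h₀ h₁
  set P : Plane → ℝ := fun y => G₀ y * fderiv ℝ z y e₀ + G₁ y * fderiv ℝ z y e₁ with hP
  have hvec : ∀ v : Plane, v = v 0 • e₀ + v 1 • e₁ := by
    intro v; ext i; fin_cases i <;> simp [he₀, he₁]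
  have hfd : ∀ y v : Plane, fderiv ℝ z y v = v 0 * fderiv ℝ z y e₀ + v 1 * fderiv ℝ z y e₁ := by
    intro y v
    conv_lhs => rw [hvec v]
    simp
  have hnsq : ∀ v : Plane, ‖v‖ ^ 2 = v 0 ^ 2 + v 1 ^ 2 := fun v => by
    simp [EuclideanSpace.real_norm_sq_eq, Fin.sum_univ_two]
  have hPmeas : AEStronglyMeasurable P (volume.restrict Ω) :=
    (hG₀c.aestronglyMeasurable.mul (hint.apply_continuousLinearMap e₀).1).add
      (hG₁c.aestronglyMeasurable.mul (hint.apply_continuousLinearMap e₁).1)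
  have hPint : IntegrableOn P Ω := by
    have hG : ∀ (G : Plane → ℝ) (e : Plane), Continuous G →
        IntegrableOn (fun x => G x * fderiv ℝ z x e) Ω := fun G e hG => by
      obtain ⟨S, hS⟩ := hb.isCompact_closure.exists_bound_of_continuousOn hG.continuousOn
      refine (hint.apply_continuousLinearMap e).bdd_mul (c := S)
        hG.aestronglyMeasurable.restrict ?_
      exact (ae_restrict_iff' hΩ.measurableSet).2
        (Eventually.of_forall fun x hx => hS x (subset_closure hx))
    exact (hG _ _ hG₀c).add (hG _ _ hG₁c)
  set Q : Plane → ℝ := fun y => log (‖x - y‖ ^ 2 + d) * fderiv ℝ z y y with hQ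
  set rot : Plane → Plane := fun y => !₂[y 1 - b, -(y 0 - a)] with hrot
  have hrotn : ∀ y, ‖rot y‖ = ‖y - x‖ := fun y => by
    rw [← sq_eq_sq₀ (norm_nonneg _) (norm_nonneg _), hnsq, hnsq]
    simp [hrot]; ring
  have hQP : ∀ y, Q y - P y =
      log (N y) * fderiv ℝ z y (y - x) - 2 * ℓ y / N y * fderiv ℝ z y (rot y) := by
    intro y
    have := hNne y
    rw [hfd y (y - x), hfd y (rot y)]
    simp only [hQ, hP, hG₀, hG₁]
    rw [hfd y y, norm_sub_rev, show ‖y - x‖ ^ 2 + d = N y from rfl]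
    simp [hrot, ← ha, ← hb']
    ring
  have hxR := hR x hx
  have hR0 : 0 ≤ R := (norm_nonneg x).trans hxR
  have hbound : ∀ y ∈ Ω, ‖Q y - P y‖ ≤ (8 * R ^ 2 + 4 + 2 * R) * ‖fderiv ℝ z y‖ := by
    intro y hy
    set s := ‖y - x‖ with hs
    have hs0 : 0 ≤ s := norm_nonneg _
    have hs2 : s ≤ 2 * R := (norm_sub_le _ _).trans (by linarith [hR y hy])
    have hNs : N y = s ^ 2 + d := rfl
    have hlog : |log (N y)| * s ≤ 8 * R ^ 2 + 4 := by
      set m := √(N y) with hm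
      have hmpos : 0 < m := sqrt_pos.2 (hNpos y)
      have hm2 : m ^ 2 = N y := sq_sqrt (hNpos y).le
      have hsm : s ≤ m := le_sqrt_of_sq_le (by rw [hNs]; linarith)
      have h1 := abs_log_le_add_inv hmpos
      have h2 : |log (N y)| = 2 * |log m| := by
        rw [← hm2, log_pow, abs_mul]; simp
      have h3 : |log m| * s ≤ (m + 1 / m) * m := by gcongr
      have h4 : (m + 1 / m) * m = N y + 1 := by rw [← hm2]; field_simp
      rw [h2]
      nlinarith
    have hℓb : |ℓ y| ≤ R * s := by
      refine le_trans (abs_le_of_sq_le_sq (b := ‖x‖ * s) ?_ (by positivity)) (by gcongr)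
      rw [mul_pow, hnsq x, hs, hnsq (y - x)]
      simp only [hℓ, PiLp.sub_apply, ← ha, ← hb']
      nlinarith [sq_nonneg (a * (y 0 - a) + b * (y 1 - b))]
    have hrotb : |2 * ℓ y / N y| * s ≤ 2 * R := by
      rw [abs_div, abs_of_pos (hNpos y), div_mul_eq_mul_div, div_le_iff₀ (hNpos y), abs_mul,
        abs_two, hNs]
      have := mul_le_mul_of_nonneg_right hℓb hs0
      nlinarith
    rw [hQP]
    set F := ‖fderiv ℝ z y‖ with hF
    have hF0 : 0 ≤ F := norm_nonneg _
    have t1 : ‖log (N y) * fderiv ℝ z y (y - x)‖ ≤ |log (N y)| * s * F := by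
      rw [norm_mul, Real.norm_eq_abs, mul_assoc, mul_comm s F]
      gcongr
      exact (fderiv ℝ z y).le_opNorm _
    have t2 : ‖2 * ℓ y / N y * fderiv ℝ z y (rot y)‖ ≤ |2 * ℓ y / N y| * s * F := by
      rw [norm_mul, Real.norm_eq_abs, mul_assoc, mul_comm s F, hs, ← hrotn]
      gcongr
      exact (fderiv ℝ z y).le_opNorm _
    calc _ ≤ _ := norm_sub_le _ _
      _ ≤ |log (N y)| * s * F + |2 * ℓ y / N y| * s * F := add_le_add t1 t2
      _ ≤ (8 * R ^ 2 + 4) * F + 2 * R * F := by gcongr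
      _ = _ := by ring
  have hQmeas : AEStronglyMeasurable Q (volume.restrict Ω) := by
    have hzf : ContinuousOn (fderiv ℝ z) Ω := hz.continuousOn_fderiv_of_isOpen hΩ le_rfl
    refine AEStronglyMeasurable.mul (Continuous.aestronglyMeasurable ?_)
      ((hzf.clm_apply continuousOn_id).aestronglyMeasurable hΩ.measurableSet)
    exact Continuous.log (by fun_prop) fun y => by positivity
  have hbound' : ∀ᵐ y ∂volume.restrict Ω,
      ‖Q y - P y‖ ≤ (8 * R ^ 2 + 4 + 2 * R) * ‖fderiv ℝ z y‖ :=
    (ae_restrict_iff' hΩ.measurableSet).2 (Eventually.of_forall hbound)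
  have hQPint : IntegrableOn (fun y => Q y - P y) Ω :=
    (hint.norm.const_mul _).mono' (hQmeas.sub hPmeas) hbound'
  have hQeq : ∫ y in Ω, Q y = ∫ y in Ω, (Q y - P y) := by
    have hQint : IntegrableOn Q Ω := (hQPint.add hPint).congr
      (Eventually.of_forall fun y => by simp)
    rw [integral_sub hQint hPint, hdiv, sub_zero]
  rw [hQeq, ← Real.norm_eq_abs, ← integral_const_mul]
  exact norm_integral_le_of_norm_le (hint.norm.const_mul _) hbound'

/-- A sup bound for the Dirichlet problem `Δw = -c x·∇z`, `|c| ≤ 1`, in terms of the `L¹` norm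
of `∇z`. -/
lemma le_of_lap_eq_radial_drift {Ω : Set Plane} {z w : Plane → ℝ} (hΩ : IsOpen Ω)
    (hb : Bornology.IsBounded Ω) (hz : ContDiffOn ℝ 2 z Ω)
    (hzc : ContinuousOn z (closure Ω)) (hz0 : ∀ x ∈ frontier Ω, z x = 0)
    (hint : IntegrableOn (fderiv ℝ z) Ω) {R : ℝ} (hR0 : 0 ≤ R) (hR : ∀ x ∈ Ω, ‖x‖ ≤ R)
    (hw : ContDiffOn ℝ 2 w Ω) (hwc : ContinuousOn w (closure Ω))
    (hw0 : ∀ x ∈ frontier Ω, w x ≤ 0) {c : ℝ} (hc : |c| ≤ 1)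
    (hlap : ∀ x ∈ Ω, -lap w x = c * fderiv ℝ z x x) :
    ∀ x ∈ closure Ω,
      w x ≤ 2 * ((8 * R ^ 2 + 4 + 2 * R) * (∫ y in Ω, ‖fderiv ℝ z y‖)) := by
  have hΩm := hΩ.measurableSet
  have hz1 : ContDiffOn ℝ 1 z Ω := hz.of_le (by norm_num)
  have hzf : ContinuousOn (fderiv ℝ z) Ω := hz1.continuousOn_fderiv_of_isOpen hΩ le_rfl
  set g : Plane → ℝ := fun x => c * fderiv ℝ z x x with hg
  have hgc : ContinuousOn g Ω := continuousOn_const.mul (hzf.clm_apply continuousOn_id)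
  set G := Ω.indicator g with hG
  have hGint : Integrable G := by
    rw [hG, integrable_indicator_iff hΩm]
    refine (hint.norm.const_mul R).mono' (hgc.aestronglyMeasurable hΩm)
      ((ae_restrict_iff' hΩm).2 (Eventually.of_forall fun x hx => ?_))
    have h1 := (fderiv ℝ z x).le_opNorm x
    have h2 : ‖fderiv ℝ z x‖ * ‖x‖ ≤ ‖fderiv ℝ z x‖ * R := by gcongr; exact hR x hx
    rw [norm_mul, Real.norm_eq_abs c]
    nlinarith [norm_nonneg (fderiv ℝ z x x)]
  have hGR : ∀ y, R < ‖y‖ → G y = 0 := fun y hy =>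
    indicator_of_notMem (fun h => absurd (hR y h) (not_le.2 hy)) _
  have hπ := pi_gt_three
  refine le_two_mul_of_approx_lap hΩ hb hw hwc hw0 (by positivity) fun K hKΩ hK η hη => ?_
  obtain ⟨d, hd, hd1, hclose⟩ := exists_approxDelta_close hGint hK
    (fun x hx => (hgc.continuousAt (hΩ.mem_nhds (hKΩ hx))).congr (by
      filter_upwards [hΩ.mem_nhds (hKΩ hx)] with y hy using (indicator_of_mem hy g).symm)) hη
  obtain ⟨D, hD⟩ := exists_secondLineDeriv_logPotential hd hGint hGR
  refine ⟨fun x => -(1 / (4 * π)) * logPotential d G x, fun x i => -(1 / (4 * π)) * D x i,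
    (continuous_const.mul (continuous_logPotential hd hGint hGR)).continuousOn,
    fun x hx => ?_, fun x hx => ⟨fun i => ((hD x).1 i).const_mul _, ?_⟩⟩
  · have h1 : logPotential d G x = c * ∫ y in Ω, log (‖x - y‖ ^ 2 + d) * fderiv ℝ z y y := by
      rw [logPotential, ← integral_const_mul, ← integral_indicator hΩm]
      congr 1
      funext y
      by_cases hy : y ∈ Ω
      · simp [hG, hg, hy]; ring
      · simp [hG, hy]
    have h2 := integral_log_mul_fderiv_bound hΩ hb hz1 hzc hz0 hint hR hd hd1 hx
    have h3 : 1 / (4 * π) ≤ 1 := by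
      rw [div_le_one (by positivity)]; linarith
    rw [abs_mul, abs_neg, abs_of_pos (by positivity : 0 < 1 / (4 * π)), h1, abs_mul]
    have h4 := mul_le_mul h3 (mul_le_mul hc h2 (abs_nonneg _) zero_le_one) (by positivity)
      zero_le_one
    rwa [one_mul, one_mul] at h4
  · have h1 := (abs_lt.1 (hclose x hx)).1
    have h2 : G x = g x := indicator_of_mem (hKΩ hx) g
    rw [← Finset.mul_sum, (hD x).2, ← mul_assoc,
      show -(1 / (4 * π)) * (4 * π) = -1 by field_simp]
    have h3 : -lap w x = g x := hlap x (hKΩ hx)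
    linarith

lemma lap_neg {w : Plane → ℝ} (x : Plane) : lap (fun y => -w y) x = -lap w x := by
  have := iteratedFDeriv_neg_apply (𝕜 := ℝ) (i := 2) (f := w) (x := x)
  have h : (fun y => -w y) = -w := rfl
  simp [lap, h, this]

lemma lap_sub {n : ℕ} {v w : EuclideanSpace ℝ (Fin n) → ℝ} {x : EuclideanSpace ℝ (Fin n)}
    (hv : ContDiffAt ℝ 2 v x) (hw : ContDiffAt ℝ 2 w x) :
    lap (fun y => v y - w y) x = lap v x - lap w x := by
  have h : (fun y => v y - w y) = v - w := rfl
  simp [lap, h, iteratedFDeriv_sub_apply hv hw, Finset.sum_sub_distrib]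

lemma le_zero_of_lap_nonneg {Ω : Set Plane} {w : Plane → ℝ} (hΩ : IsOpen Ω)
    (hb : Bornology.IsBounded Ω) (hw : ContDiffOn ℝ 2 w Ω) (hwc : ContinuousOn w (closure Ω))
    (hw0 : ∀ x ∈ frontier Ω, w x ≤ 0) (hlap : ∀ x ∈ Ω, 0 ≤ lap w x) :
    ∀ x ∈ closure Ω, w x ≤ 0 := by
  have := le_two_mul_of_approx_lap hΩ hb hw hwc hw0 le_rfl fun K hK _ η hη =>
    ⟨fun _ => 0, fun _ _ => 0, continuousOn_const, fun x _ => by simp, fun x hx =>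
      ⟨fun i => ⟨fun _ => 0, Eventually.of_forall fun t => hasDerivAt_const _ _,
        hasDerivAt_const _ _⟩, by simpa using by linarith [hlap x (hK hx)]⟩⟩
  simpa using this

/- STATEMENT 15: in a bounded domain `Ω ⊂ ℝ²`, for a family (indexed by `i`, with
parameters `ε i > 0`) of Dirichlet solutions `z i` of `-Δz - ε x·∇z = f` with
`‖f i‖_{L¹(Ω)} ≤ C` and the Stampacchia/Brezis–Strauss bound `‖∇z i‖_{L^q(Ω)} ≤ C_q`
(`1 ≤ q < 2`), if `w i` solves `-Δw = ε x·∇z` with Dirichlet data and `u i` solves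
`-Δu = f` with Dirichlet data, then `‖w i‖_{C⁰(Ω̄)}` is uniformly bounded and
`z i - w i = u i` on `Ω̄` (by the maximum principle). -/
theorem stmt15 (Ω : Set (EuclideanSpace ℝ (Fin 2))) (hΩopen : IsOpen Ω)
    (hΩbdd : Bornology.IsBounded Ω)
    (ε : ℕ → ℝ) (hε : ∀ i, 0 < ε i ∧ ε i ≤ 1)
    (f z w u : ℕ → EuclideanSpace ℝ (Fin 2) → ℝ)
    (C : ℝ) (q : ℝ) (hq1 : 1 ≤ q) (hq2 : q < 2) (Cq : ℝ)
    (hreg : ∀ i, ContDiffOn ℝ 2 (z i) Ω ∧ ContinuousOn (z i) (closure Ω) ∧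
      ContDiffOn ℝ 2 (w i) Ω ∧ ContinuousOn (w i) (closure Ω) ∧
      ContDiffOn ℝ 2 (u i) Ω ∧ ContinuousOn (u i) (closure Ω))
    (hfL1 : ∀ i, ∫ x in Ω, |f i x| ≤ C)
    (hz : ∀ i, ∀ x ∈ Ω, -lap (z i) x - ε i * fderiv ℝ (z i) x x = f i x)
    (hz0 : ∀ i, ∀ x ∈ frontier Ω, z i x = 0)
    (hgrad : ∀ i, eLpNorm (fun x => fderiv ℝ (z i) x) (ENNReal.ofReal q)
      (volume.restrict Ω) ≤ ENNReal.ofReal Cq)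
    (hw : ∀ i, ∀ x ∈ Ω, -lap (w i) x = ε i * fderiv ℝ (z i) x x)
    (hw0 : ∀ i, ∀ x ∈ frontier Ω, w i x = 0)
    (hu : ∀ i, ∀ x ∈ Ω, -lap (u i) x = f i x)
    (hu0 : ∀ i, ∀ x ∈ frontier Ω, u i x = 0) :
    (∃ C₀ : ℝ, ∀ i, ∀ x ∈ closure Ω, |w i x| ≤ C₀) ∧
    (∀ i, ∀ x ∈ closure Ω, z i x - w i x = u i x) := by
  have hΩm := hΩopen.measurableSet
  obtain ⟨R₀, hR₀⟩ := hΩbdd.exists_norm_le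
  set R := max R₀ 0 with hRdef
  have hR : ∀ x ∈ Ω, ‖x‖ ≤ R := fun x hx => (hR₀ x hx).trans (le_max_left _ _)
  have hR0 : 0 ≤ R := le_max_right _ _
  set B := ENNReal.ofReal Cq *
    (volume.restrict Ω) univ ^ (1 / (1 : ENNReal).toReal - 1 / (ENNReal.ofReal q).toReal) with hB
  have hBtop : B ≠ ⊤ := by
    have hvol : (volume.restrict Ω) univ ≠ ⊤ := by
      simpa using hΩbdd.measure_lt_top.ne
    refine ENNReal.mul_ne_top ENNReal.ofReal_ne_top (ENNReal.rpow_ne_top_of_nonneg ?_ hvol)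
    rw [ENNReal.toReal_ofReal (by linarith)]
    simpa using inv_le_one_of_one_le₀ hq1
  have hgradInt : ∀ i, IntegrableOn (fderiv ℝ (z i)) Ω ∧
      ∫ y in Ω, ‖fderiv ℝ (z i) y‖ ≤ B.toReal := by
    intro i
    have hm : AEStronglyMeasurable (fderiv ℝ (z i)) (volume.restrict Ω) :=
      (((hreg i).1.of_le (by norm_num) : ContDiffOn ℝ 1 (z i) Ω).continuousOn_fderiv_of_isOpen
        hΩopen le_rfl).aestronglyMeasurable hΩm
    have h1 : eLpNorm (fderiv ℝ (z i)) 1 (volume.restrict Ω) ≤ B :=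
      (eLpNorm_le_eLpNorm_mul_rpow_measure_univ
        (ENNReal.one_le_ofReal.2 hq1) hm).trans (mul_le_mul_left (hgrad i) _)
    have h2 : IntegrableOn (fderiv ℝ (z i)) Ω :=
      memLp_one_iff_integrable.1 ⟨hm, h1.trans_lt hBtop.lt_top⟩
    refine ⟨h2, ?_⟩
    rw [integral_norm_eq_lintegral_enorm hm, ← eLpNorm_one_eq_lintegral_enorm]
    exact ENNReal.toReal_mono hBtop h1
  constructor
  · refine ⟨2 * ((8 * R ^ 2 + 4 + 2 * R) * B.toReal), fun i x hx => ?_⟩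
    obtain ⟨hz2, hzc, hw2, hwc, -, -⟩ := hreg i
    obtain ⟨hint, hle⟩ := hgradInt i
    have hεi : |ε i| ≤ 1 := by rw [abs_of_pos (hε i).1]; exact (hε i).2
    have h1 := le_of_lap_eq_radial_drift hΩopen hΩbdd hz2 hzc (hz0 i) hint hR0 hR hw2 hwc
      (fun x hx => (hw0 i x hx).le) hεi (hw i) x hx
    have h2 := le_of_lap_eq_radial_drift hΩopen hΩbdd hz2 hzc (hz0 i) hint hR0 hR hw2.neg hwc.neg
      (fun x hx => by simp [hw0 i x hx]) (c := -ε i) (by rwa [abs_neg])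
      (fun x hx => by rw [lap_neg, hw i x hx, neg_mul]) x hx
    have h3 : 2 * ((8 * R ^ 2 + 4 + 2 * R) * ∫ y in Ω, ‖fderiv ℝ (z i) y‖) ≤
        2 * ((8 * R ^ 2 + 4 + 2 * R) * B.toReal) := by gcongr
    rw [abs_le]
    constructor <;> linarith
  · intro i x hx
    obtain ⟨hz2, hzc, hw2, hwc, hu2, huc⟩ := hreg i
    have hlap : ∀ y ∈ Ω, lap (fun y => z i y - w i y - u i y) y = 0 := fun y hy => by
      have hmem := hΩopen.mem_nhds hy
      rw [lap_sub ((hz2.contDiffAt hmem).sub (hw2.contDiffAt hmem)) (hu2.contDiffAt hmem),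
        lap_sub (hz2.contDiffAt hmem) (hw2.contDiffAt hmem)]
      linarith [hz i y hy, hw i y hy, hu i y hy]
    have hbdry : ∀ y ∈ frontier Ω, z i y - w i y - u i y = 0 := fun y hy => by
      rw [hz0 i y hy, hw0 i y hy, hu0 i y hy]; simp
    have hC2 := (hz2.sub hw2).sub hu2
    have hC := (hzc.sub hwc).sub huc
    have h1 := le_zero_of_lap_nonneg hΩopen hΩbdd hC2 hC (fun y hy => (hbdry y hy).le)
      (fun y hy => (hlap y hy).ge) x hx
    have h2 := le_zero_of_lap_nonneg hΩopen hΩbdd hC2.neg hC.neg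
      (fun y hy => by simp [hbdry y hy])
      (fun y hy => by rw [lap_neg]; exact (neg_eq_zero.2 (hlap y hy)).ge) x hx
    linarith
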